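/- arXiv:1903.07399 — 6 statements merged into one kernel-verified Lean document; each statement's English description precedes it below -/
import Mathlib

section
/- Let X be a real Banach space, f ∈ X, and let N : X → X be analytic at f with infinite radius of convergence. Assume ‖N^{(n)}(f)‖ ≤ M a^n n! for all n ∈ ℕ, where M, a > 0 satisfy Ma ≤ 1/4. Then the Adomian series ∑_{n≥0} u_n is absolutely convergent in X, i.e. ∑_{n=0}^{∞} ‖u_n‖ < ∞. -/
open scoped BigOperators

variable {X : Type*} [NormedAddCommGroup X] [NormedSpace ℝ X] [CompleteSpace X]

/-- The set of tuples `(j 0, …, j (n-1))` of nonnegative integers (representing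
`(j_1, …, j_n)`) with `j_1 + 2 j_2 + ⋯ + n j_n = n`. -/
def adomianTuples (n : ℕ) : Finset (Fin n → ℕ) :=
  (Fintype.piFinset fun _ : Fin n => Finset.range (n + 1)).filter
    fun j => ∑ i : Fin n, (i.1 + 1) * j i = n

/-- The list consisting of `j i` copies of `g i`, for `i = 0, …, n-1` in order. -/
def repList {X : Type*} {n : ℕ} (j : Fin n → ℕ) (g : Fin n → X) : List X :=
  (List.ofFn fun i => List.replicate (j i) (g i)).flatten

theorem repList_length {X : Type*} {n : ℕ} (j : Fin n → ℕ) (g : Fin n → X) :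
    (repList j g).length = ∑ i : Fin n, j i := by
  simp [repList, List.length_flatten, List.map_ofFn, Function.comp_def, List.sum_ofFn]

/-- The family of arguments `g 0, …, g 0, g 1, …, g 1, …` with `g i` repeated `j i` times,
indexed by `Fin (∑ i, j i)`: this realizes the application
`F.(x_1^{[j_1]} ⋯ x_n^{[j_n]})` of a (symmetric) multilinear map `F`. -/
def repArgs {X : Type*} {n : ℕ} (j : Fin n → ℕ) (g : Fin n → X) :
    Fin (∑ i : Fin n, j i) → X :=
  fun k => (repList j g).get (Fin.cast (repList_length j g).symm k)

/-- The `n`-th Adomian polynomial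
`A_n = ∑_{j_1+2j_2+⋯+nj_n=n} (1/(j_1!⋯j_n!)) N^{(j_1+⋯+j_n)}(f).(u_1^{[j_1]} ⋯ u_n^{[j_n]})`,
where `N^{(p)}(f)` is the `p`-th (iterated Fréchet) derivative of `N` at `f`. -/
noncomputable def adomianA (N : X → X) (f : X) (u : ℕ → X) (n : ℕ) : X :=
  ∑ j ∈ adomianTuples n,
    (∏ i : Fin n, ((j i).factorial : ℝ))⁻¹ •
      iteratedFDeriv ℝ (∑ i : Fin n, j i) N f (repArgs j fun i => u (i.1 + 1))

/-- `N` is analytic at `f` with infinite radius of convergence: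
`N x = N f + ∑_{p≥1} (1/p!) N^{(p)}(f).(x-f)^{[p]}` for every `x ∈ X`, the series converging
absolutely, where the coefficients `N^{(p)}(f)` are the iterated Fréchet derivatives of `N`
at `f` (the `p = 0` term of the `HasSum` below being exactly `N f`). -/
def HasEntireExpansionAt (N : X → X) (f : X) : Prop :=
  ∀ x : X,
    HasSum (fun p : ℕ => ((p.factorial : ℝ))⁻¹ •
      iteratedFDeriv ℝ p N f fun _ => x - f) (N x) ∧
    Summable fun p : ℕ => ((p.factorial : ℝ))⁻¹ * ‖iteratedFDeriv ℝ p N f fun _ => x - f‖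

theorem prod_norm_repArgs {E : Type*} [Norm E] {n : ℕ} (j : Fin n → ℕ) (g : Fin n → E) :
    ∏ k, ‖repArgs j g k‖ = ∏ i, ‖g i‖ ^ j i := by
  have h : ∏ k, ‖repArgs j g k‖ = ((repList j g).map fun x => ‖x‖).prod := by
    rw [← List.prod_ofFn]
    congr 1
    apply List.ext_get
    · simp [repList_length]
    · intro k h₁ h₂
      simp [repArgs]
  rw [h]
  simp [repList, List.map_flatten, List.map_ofFn, Function.comp_def, List.prod_flatten,
    List.prod_ofFn]

/-- The extension by zero of a tuple to a function on `ℕ`. -/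
def extendTuple {m : ℕ} (j : Fin m → ℕ) (i : ℕ) : ℕ :=
  if h : i < m then j ⟨i, h⟩ else 0

theorem extendTuple_val {m : ℕ} (j : Fin m → ℕ) (i : Fin m) : extendTuple j i = j i := by
  simp [extendTuple]

@[to_additive]
theorem prod_range_extendTuple {R : Type*} [CommMonoid R] {m n : ℕ} (hmn : m ≤ n)
    (j : Fin m → ℕ) (φ : ℕ → ℕ → R) (hφ : ∀ i, φ i 0 = 1) :
    ∏ i ∈ Finset.range n, φ i (extendTuple j i) = ∏ i : Fin m, φ i (j i) := by
  rw [← Finset.prod_subset (Finset.range_subset_range.2 hmn), Finset.prod_range]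
  · simp only [extendTuple_val]
  · intro i _ hi
    rw [extendTuple, dif_neg (by simpa using hi), hφ]

theorem norm_adomianA_le {E : Type*} [NormedAddCommGroup E] [NormedSpace ℝ E]
    {N : E → E} {f : E} {M a : ℝ}
    (hderiv : ∀ n : ℕ, ‖iteratedFDeriv ℝ n N f‖ ≤ M * a ^ n * n.factorial)
    (u : ℕ → E) {m n : ℕ} (hmn : m ≤ n) :
    ‖adomianA N f u m‖ ≤ ∑ j ∈ adomianTuples m,
      M * a ^ (∑ i ∈ Finset.range n, extendTuple j i) *
        (Nat.multinomial (Finset.range n) (extendTuple j) *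
          ∏ i ∈ Finset.range n, ‖u (i + 1)‖ ^ extendTuple j i) := by
  refine norm_sum_le_of_le _ fun j _ => ?_
  have hsum : ∑ i ∈ Finset.range n, extendTuple j i = ∑ i, j i :=
    sum_range_extendTuple hmn j (fun _ k => k) fun _ => rfl
  have hprod : ∏ i ∈ Finset.range n, ‖u (i + 1)‖ ^ extendTuple j i =
      ∏ i : Fin m, ‖u (i + 1)‖ ^ j i :=
    prod_range_extendTuple hmn j (fun i k => ‖u (i + 1)‖ ^ k) fun _ => pow_zero _
  have hfact : ∏ i ∈ Finset.range n, ((extendTuple j i).factorial : ℝ) =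
      ∏ i : Fin m, ((j i).factorial : ℝ) :=
    prod_range_extendTuple hmn j (fun _ k => (k.factorial : ℝ)) fun _ => by simp
  have hpos : 0 < ∏ i : Fin m, ((j i).factorial : ℝ) :=
    Finset.prod_pos fun i _ => by positivity
  have hmult : (Nat.multinomial (Finset.range n) (extendTuple j) : ℝ) =
      (∏ i : Fin m, ((j i).factorial : ℝ))⁻¹ * (∑ i, j i).factorial := by
    have := Nat.multinomial_spec (Finset.range n) (extendTuple j)
    rw [hsum] at this
    rw [← this, ← hfact]
    push_cast
    rw [hfact, inv_mul_cancel_left₀ hpos.ne']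
  rw [hsum, hprod, hmult, norm_smul, norm_inv, Real.norm_of_nonneg hpos.le]
  have hle : ‖iteratedFDeriv ℝ (∑ i, j i) N f (repArgs j fun i => u (i.1 + 1))‖ ≤
      M * a ^ (∑ i, j i) * (∑ i, j i).factorial * ∏ i : Fin m, ‖u (i + 1)‖ ^ j i := by
    refine (ContinuousMultilinearMap.le_opNorm _ _).trans ?_
    rw [prod_norm_repArgs]
    gcongr
    exact hderiv _
  calc _ ≤ (∏ i : Fin m, ((j i).factorial : ℝ))⁻¹ * _ :=
        mul_le_mul_of_nonneg_left hle (by positivity)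
    _ = _ := by ring

theorem sum_norm_adomianA_le {E : Type*} [NormedAddCommGroup E] [NormedSpace ℝ E]
    {N : E → E} {f : E} {M a : ℝ} (hM : 0 ≤ M) (ha : 0 ≤ a)
    (hderiv : ∀ n : ℕ, ‖iteratedFDeriv ℝ n N f‖ ≤ M * a ^ n * n.factorial)
    (u : ℕ → E) (n : ℕ) :
    ∑ m ∈ Finset.range (n + 1), ‖adomianA N f u m‖ ≤
      ∑ p ∈ Finset.range (n + 1), M * (a * ∑ i ∈ Finset.range n, ‖u (i + 1)‖) ^ p := by
  classical
  let G : (ℕ → ℕ) → ℝ := fun k => M * a ^ (∑ i ∈ Finset.range n, k i) *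
    (Nat.multinomial (Finset.range n) k * ∏ i ∈ Finset.range n, ‖u (i + 1)‖ ^ k i)
  have hG : ∀ k, 0 ≤ G k := fun k => by positivity
  have hweight : ∀ m ≤ n, ∀ j ∈ adomianTuples m,
      ∑ i ∈ Finset.range n, (i + 1) * extendTuple j i = m := by
    intro m hm j hj
    rw [sum_range_extendTuple hm j (fun i k => (i + 1) * k) fun _ => rfl]
    exact (Finset.mem_filter.1 hj).2
  let e : (Σ m : ℕ, Fin m → ℕ) → ℕ → ℕ := fun x => extendTuple x.2
  let S := (Finset.range (n + 1)).sigma adomianTuples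
  let T := (Finset.range (n + 1)).biUnion fun p => Finset.piAntidiag (Finset.range n) p
  have hinj : Set.InjOn e S := by
    rintro ⟨m, j⟩ hj ⟨m', j'⟩ hj' hjj
    simp only [S, Finset.coe_sigma, Set.mem_sigma_iff, Finset.coe_range, Set.mem_Iio,
      Finset.mem_coe] at hj hj'
    change extendTuple j = extendTuple j' at hjj
    obtain rfl : m = m' := by
      rw [← hweight m (by lia) j hj.2, hjj, hweight m' (by lia) j' hj'.2]
    congr 1
    ext i
    rw [← extendTuple_val j, hjj, extendTuple_val]
  have hmaps : S.image e ⊆ T := by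
    intro k hk
    obtain ⟨⟨m, j⟩, hj, rfl⟩ := Finset.mem_image.1 hk
    simp only [S, Finset.mem_sigma, Finset.mem_range] at hj
    have hw := hweight m (by lia) j hj.2
    have hle : ∑ i ∈ Finset.range n, extendTuple j i ≤ m :=
      (Finset.sum_le_sum fun i _ => Nat.le_mul_of_pos_left _ i.succ_pos).trans_eq hw
    simp only [T, Finset.mem_biUnion, Finset.mem_range, Finset.mem_piAntidiag]
    refine ⟨_, lt_of_le_of_lt hle hj.1, rfl, fun i hi => ?_⟩
    by_contra hin
    exact hi (dif_neg (by lia))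
  calc ∑ m ∈ Finset.range (n + 1), ‖adomianA N f u m‖
      ≤ ∑ m ∈ Finset.range (n + 1), ∑ j ∈ adomianTuples m, G (extendTuple j) :=
        Finset.sum_le_sum fun m hm =>
          norm_adomianA_le hderiv u (Nat.lt_succ_iff.1 (Finset.mem_range.1 hm))
    _ = ∑ k ∈ S.image e, G k := by
        rw [Finset.sum_image hinj, Finset.sum_sigma]
    _ ≤ ∑ k ∈ T, G k := Finset.sum_le_sum_of_subset_of_nonneg hmaps fun k _ _ => hG k
    _ = ∑ p ∈ Finset.range (n + 1), ∑ k ∈ Finset.piAntidiag (Finset.range n) p, G k := by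
        refine Finset.sum_biUnion fun p _ q _ hpq => Finset.disjoint_left.2 fun k hp hq => hpq ?_
        rw [← (Finset.mem_piAntidiag.1 hp).1, (Finset.mem_piAntidiag.1 hq).1]
    _ = _ := by
        refine Finset.sum_congr rfl fun p _ => ?_
        rw [mul_pow, Finset.sum_pow_eq_sum_piAntidiag, ← mul_assoc, Finset.mul_sum]
        refine Finset.sum_congr rfl fun k hk => ?_
        simp only [G, (Finset.mem_piAntidiag.1 hk).1]

/-- If `N` is analytic at `f` with infinite radius of convergence and
`‖N^{(n)}(f)‖ ≤ M a^n n!` for all `n`, with `M, a > 0` and `M a ≤ 1/4`, then the Adomian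
series `∑ u_n` (where `u_0 = f` and `u_{n+1} = A_n`) is absolutely convergent in `X`. -/
theorem adomian_absolutely_convergent
    (N : X → X) (f : X) (M a : ℝ) (hM : 0 < M) (ha : 0 < a) (hMa : M * a ≤ 1 / 4)
    (hN : HasEntireExpansionAt N f)
    (hderiv : ∀ n : ℕ, ‖iteratedFDeriv ℝ n N f‖ ≤ M * a ^ n * n.factorial)
    (u : ℕ → X) (hu0 : u 0 = f) (hu : ∀ n : ℕ, u (n + 1) = adomianA N f u n) :
    Summable fun n : ℕ => ‖u n‖ := by
  have hbound : ∀ n, ∑ i ∈ Finset.range n, ‖u (i + 1)‖ ≤ 1 / (2 * a) := by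
    intro n
    induction n with
    | zero => simp; positivity
    | succ n ih =>
      simp only [hu] at ih ⊢
      refine (sum_norm_adomianA_le hM.le ha.le hderiv u n).trans ?_
      have hhalf : a * ∑ i ∈ Finset.range n, ‖u (i + 1)‖ ≤ 1 / 2 := by
        simp only [hu]
        calc _ ≤ a * (1 / (2 * a)) := by gcongr
          _ = 1 / 2 := by field_simp
      calc _ ≤ ∑ p ∈ Finset.range (n + 1), M * (1 / 2 : ℝ) ^ p := by gcongr
        _ ≤ M * 2 := by
          rw [← Finset.mul_sum]
          gcongr
          exact sum_geometric_two_le _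
        _ ≤ 1 / (2 * a) := by
          rw [le_div_iff₀ (by positivity)]
          linarith
  exact (summable_nat_add_iff 1).1
    (summable_of_sum_range_le (fun _ => norm_nonneg _) hbound)
end

section
/- Let X be a real Banach space, f ∈ X, and let N : X → X be analytic at f with infinite radius of convergence. Assume ‖N^{(n)}(f)‖ ≤ M a^n n! for all n ∈ ℕ, where M, a > 0 satisfy Ma ≤ 1/4. Then the sum u := ∑_{n=0}^{∞} u_n of the Adomian series is a solution of the equation u = f + N(u). -/
open scoped BigOperators

variable {X : Type*} [NormedAddCommGroup X] [NormedSpace ℝ X] [CompleteSpace X]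

open Finset in
/-- Two functions whose fibers have the same cardinalities differ by a permutation. -/
theorem exists_perm_comp_eq_of_card_fiber_eq {α β : Type*} [Fintype α] [DecidableEq β]
    {s t : α → β} (h : ∀ b, #{a | s a = b} = #{a | t a = b}) :
    ∃ σ : Equiv.Perm α, t ∘ σ = s := by
  have e : ∀ b, Nonempty ({a // s a = b} ≃ {a // t a = b}) := fun b ↦ by
    rw [← Fintype.card_eq, Fintype.card_subtype, Fintype.card_subtype, h b]
  exact ⟨Equiv.ofFiberEquiv fun b ↦ (e b).some, funext fun a ↦ Equiv.ofFiberEquiv_map _ a⟩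

open Finset in
/-- The number of functions with the same fiber cardinalities as `t` is a multinomial
coefficient. -/
theorem card_same_card_fiber_mul_prod_factorial {α β : Type*} [Fintype α] [DecidableEq α]
    [Fintype β] [DecidableEq β] (t : α → β) :
    #{s : α → β | ∀ b, #{a | s a = b} = #{a | t a = b}} * ∏ b, (#{a | t a = b}).factorial
      = (Fintype.card α).factorial := by
  rw [← Fintype.card_perm, ← card_univ (α := Equiv.Perm α),
    card_eq_sum_card_fiberwise (f := fun σ : Equiv.Perm α ↦ t ∘ σ)
      (t := {s : α → β | ∀ b, #{a | s a = b} = #{a | t a = b}})]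
  · symm
    rw [← smul_eq_mul, ← sum_const]
    refine sum_congr rfl fun s hs ↦ ?_
    obtain ⟨τ, rfl⟩ := exists_perm_comp_eq_of_card_fiber_eq (mem_filter.1 hs).2
    have h := DomMulAct.stabilizer_card t
    simp only [Fintype.card_subtype] at h
    rw [← h]
    symm
    refine card_equiv (Equiv.mulRight τ) fun σ ↦ ?_
    simp only [mem_filter, mem_univ, true_and, Equiv.coe_mulRight, Equiv.Perm.coe_mul,
      ← Function.comp_assoc]
    exact ⟨fun hσ ↦ by rw [hσ], fun hσ ↦ τ.surjective.injective_comp_right hσ⟩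
  · intro σ _
    simp only [coe_filter, mem_univ, true_and, Set.mem_ofPred_eq]
    exact fun b ↦ card_equiv σ fun a ↦ by simp

theorem repList_map {Y Z : Type*} {n : ℕ} (j : Fin n → ℕ) (g : Fin n → Y) (φ : Y → Z) :
    (repList j g).map φ = repList j (φ ∘ g) := by
  simp [repList, List.map_flatten, List.map_ofFn, Function.comp_def]

theorem repArgs_eq_comp {Y : Type*} {n : ℕ} (j : Fin n → ℕ) (g : Fin n → Y) :
    repArgs j g = g ∘ repArgs j id := by
  funext k
  have h : repList j g = (repList j id).map g := (repList_map j id g).symm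
  simp [repArgs, List.getElem_of_eq h]

theorem count_repList {n : ℕ} (j : Fin n → ℕ) (i : Fin n) : (repList j id).count i = j i := by
  simp [repList, List.count_flatten, List.map_ofFn, Function.comp_def, List.sum_ofFn,
    List.count_replicate]

open Finset in
theorem card_fiber_repArgs {n : ℕ} (j : Fin n → ℕ) (i : Fin n) :
    #{k | repArgs j id k = i} = j i := by
  rw [← count_repList j i]
  have : List.ofFn (repArgs j id) = repList j id := by
    apply List.ext_getElem <;> simp [repList_length, repArgs]
  rw [← this, ← Multiset.coe_count, ← Fin.univ_val_map, Multiset.count_map]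
  simp [Finset.card, eq_comm]

/-- The index set of the terms `c p (v (i 0), …, v (i (p-1)))` of the multilinear expansion of
`∑ p, c p (∑ k, v k, …, ∑ k, v k)`. -/
abbrev ExpansionIndex : Type := Σ p : ℕ, Fin p → ℕ

namespace ExpansionIndex

/-- The degree of the term with index `(p, i)` when `v k` has degree `k + 1`. -/
def weight (t : ExpansionIndex) : ℕ := ∑ k, (t.2 k + 1)

/-- The indices `(p, i)` with `p < P` and all `i k < K`. -/
def box (P K : ℕ) : Finset ExpansionIndex :=
  (Finset.range P).sigma fun _ ↦ Fintype.piFinset fun _ ↦ Finset.range K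

/-- The indices of weight `n`. -/
def ofWeight (n : ℕ) : Finset ExpansionIndex := {t ∈ box (n + 1) n | t.weight = n}

theorem mem_box {P K : ℕ} {t : ExpansionIndex} :
    t ∈ box P K ↔ t.1 < P ∧ ∀ k, t.2 k < K := by
  simp [box]

theorem mem_ofWeight {n : ℕ} {t : ExpansionIndex} : t ∈ ofWeight n ↔ t.weight = n := by
  refine ⟨fun h ↦ (Finset.mem_filter.1 h).2, fun h ↦ Finset.mem_filter.2 ⟨mem_box.2 ⟨?_, ?_⟩, h⟩⟩
  · rw [← h, weight, Finset.sum_add_distrib]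
    simp
  · intro k
    rw [← h]
    exact Finset.single_le_sum (f := fun k ↦ t.2 k + 1) (fun _ _ ↦ Nat.zero_le _)
      (Finset.mem_univ k)

theorem exists_subset_box (s : Finset ExpansionIndex) : ∃ n, s ⊆ box n n := by
  refine ⟨s.sup weight + 1, fun t ht ↦ ?_⟩
  have h := mem_box.1 (Finset.mem_filter.1 (mem_ofWeight.2 (rfl : t.weight = t.weight))).1
  have h' := Finset.le_sup (f := weight) ht
  exact mem_box.2 ⟨by omega, fun k ↦ by have := h.2 k; omega⟩

end ExpansionIndex

open Finset ExpansionIndex in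
/-- The Adomian polynomial is the sum of the terms of weight `n` of the multilinear expansion. -/
theorem adomianA_eq_sum_ofWeight {E : Type*} [NormedAddCommGroup E] [NormedSpace ℝ E]
    {N : E → E} {f : E} (hN : ContDiffAt ℝ ⊤ N f) (u : ℕ → E) (n : ℕ) :
    adomianA N f u n = ∑ t ∈ ofWeight n, ((t.1.factorial : ℝ))⁻¹ •
      iteratedFDeriv ℝ t.1 N f fun k ↦ u (t.2 k + 1) := by
  let S : Finset (Σ p : ℕ, Fin p → Fin n) :=
    {t ∈ (range (n + 1)).sigma fun _ ↦ univ | ∑ k, ((t.2 k : ℕ) + 1) = n}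
  let F : (Σ p : ℕ, Fin p → Fin n) → E := fun t ↦ ((t.1.factorial : ℝ))⁻¹ •
      iteratedFDeriv ℝ t.1 N f fun k ↦ u (t.2 k + 1)
  let cnt : (Σ p : ℕ, Fin p → Fin n) → Fin n → ℕ := fun t b ↦ #{k | t.2 k = b}
  have weight_eq : ∀ t, ∑ k, ((t.2 k : ℕ) + 1) = ∑ b : Fin n, (b.1 + 1) * cnt t b := fun t ↦ by
    rw [← sum_fiberwise univ t.2]
    refine sum_congr rfl fun b _ ↦ ?_
    rw [sum_congr rfl (g := fun _ ↦ b.1 + 1) fun k hk ↦ by rw [(mem_filter.1 hk).2], sum_const,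
      smul_eq_mul, mul_comm]
  have length_eq : ∀ t, t.1 = ∑ b : Fin n, cnt t b := fun t ↦ by
    simpa using card_eq_sum_card_fiberwise (f := t.2) (s := univ) (t := univ) (by simp)
  have hS : ∑ t ∈ S, F t = ∑ t ∈ ofWeight n, ((t.1.factorial : ℝ))⁻¹ •
      iteratedFDeriv ℝ t.1 N f fun k ↦ u (t.2 k + 1) := by
    refine sum_bij (fun t _ ↦ ⟨t.1, fun k ↦ t.2 k⟩) ?_ ?_ ?_ ?_
    · intro t ht
      exact mem_ofWeight.2 (mem_filter.1 ht).2
    · rintro ⟨p, i⟩ _ ⟨q, j⟩ _ h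
      obtain rfl : p = q := congrArg Sigma.fst h
      simp only [Sigma.mk.injEq, heq_eq_eq, true_and] at h ⊢
      exact funext fun k ↦ Fin.ext (congrFun h k)
    · rintro ⟨p, i⟩ h
      have hb := mem_box.1 (mem_filter.1 h).1
      exact ⟨⟨p, fun k ↦ ⟨i k, hb.2 k⟩⟩,
        mem_filter.2 ⟨by simpa using hb.1, mem_ofWeight.1 h⟩, rfl⟩
    · intros; rfl
  rw [← hS, ← sum_fiberwise_of_maps_to (g := cnt) (t := adomianTuples n), adomianA]
  · refine sum_congr rfl fun j hj ↦ ?_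
    have hjn := (mem_filter.1 hj).2
    have hfib : ({t ∈ S | cnt t = j} : Finset _) =
        ({i | ∀ b, #{k | i k = b} = #{k | repArgs j id k = b}} :
          Finset (Fin (∑ b, j b) → Fin n)).map (Function.Embedding.sigmaMk _) := by
      ext ⟨p, i⟩
      simp only [mem_filter, mem_map, mem_univ, true_and, card_fiber_repArgs,
        Function.Embedding.sigmaMk_apply]
      constructor
      · rintro ⟨_, rfl⟩
        have : ∀ q, p = q → ∃ i' : Fin q → Fin n, (⟨q, i'⟩ : Σ p : ℕ, Fin p → Fin n) = ⟨p, i⟩ := by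
          rintro _ rfl
          exact ⟨i, rfl⟩
        obtain ⟨i', hi⟩ := this _ (length_eq ⟨p, i⟩)
        exact ⟨i', fun b ↦ congrFun (congrArg cnt hi) b, hi⟩
      · rintro ⟨i', h, hi⟩
        rw [← hi]
        have hc : cnt ⟨_, i'⟩ = j := funext h
        refine ⟨mem_filter.2 ⟨?_, ?_⟩, hc⟩
        · simp only [mem_sigma, mem_range, mem_univ, and_true, Order.lt_add_one_iff]
          calc _ ≤ ∑ b : Fin n, (b.1 + 1) * j b :=
                sum_le_sum fun b _ ↦ Nat.le_mul_of_pos_left _ b.1.succ_pos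
            _ = n := hjn
        · rw [weight_eq, hc, hjn]
    rw [hfib, sum_map]
    have hconst : ∀ i ∈ ({i | ∀ b, #{k | i k = b} = #{k | repArgs j id k = b}} :
          Finset (Fin (∑ b, j b) → Fin n)), F ⟨_, i⟩ = ((∑ b, j b).factorial : ℝ)⁻¹ •
            iteratedFDeriv ℝ (∑ b, j b) N f (repArgs j fun i => u (i.1 + 1)) := by
      intro i hi
      obtain ⟨σ, rfl⟩ := exists_perm_comp_eq_of_card_fiber_eq (mem_filter.1 hi).2
      rw [repArgs_eq_comp j fun i => u (i.1 + 1), ← hN.iteratedFDeriv_comp_perm _ σ]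
      rfl
    have hcard := card_same_card_fiber_mul_prod_factorial (repArgs j id)
    simp only [card_fiber_repArgs, Fintype.card_fin] at hcard
    simp only [card_fiber_repArgs] at hconst ⊢
    simp only [Function.Embedding.sigmaMk_apply]
    rw [sum_congr rfl hconst, sum_const, ← Nat.cast_smul_eq_nsmul ℝ, smul_smul, ← hcard]
    congr 1
    have h1 : ((#{x : Fin (∑ b, j b) → Fin n | ∀ b, #{a | x a = b} = j b} : ℕ) : ℝ) ≠ 0 := by
      intro h0
      rw [Nat.cast_eq_zero] at h0
      exact (Nat.factorial_pos (∑ b, j b)).ne (by rw [← hcard, h0, zero_mul])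
    push_cast
    field_simp
  · intro t ht
    have h := (mem_filter.1 ht).2
    rw [weight_eq] at h
    refine mem_filter.2 ⟨Fintype.mem_piFinset.2 fun b ↦ mem_range.2 (Nat.lt_succ_of_le ?_), h⟩
    calc cnt t b ≤ (b.1 + 1) * cnt t b := Nat.le_mul_of_pos_left _ b.1.succ_pos
      _ ≤ ∑ b : Fin n, (b.1 + 1) * cnt t b :=
        single_le_sum (f := fun b : Fin n ↦ (b.1 + 1) * cnt t b) (fun _ _ ↦ Nat.zero_le _)
          (mem_univ b)
      _ = n := h

section Expansion

open Finset ExpansionIndex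

variable {E F : Type*} [NormedAddCommGroup E] [NormedSpace ℝ E] [NormedAddCommGroup F]
  [NormedSpace ℝ F] {c : FormalMultilinearSeries ℝ E F} {M a : ℝ} {v : ℕ → E}

theorem sum_box_norm_le (hM : 0 ≤ M) (ha : 0 ≤ a) (hc : ∀ p, ‖c p‖ ≤ M * a ^ p) {K : ℕ}
    (hv : a * ∑ k ∈ range K, ‖v k‖ ≤ 1 / 2) (P : ℕ) :
    ∑ t ∈ box P K, ‖c t.1 fun k ↦ v (t.2 k)‖ ≤ 2 * M := by
  have hv0 : 0 ≤ a * ∑ k ∈ range K, ‖v k‖ := by positivity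
  calc ∑ t ∈ box P K, ‖c t.1 fun k ↦ v (t.2 k)‖
      ≤ ∑ t ∈ box P K, M * a ^ t.1 * ∏ k, ‖v (t.2 k)‖ :=
        sum_le_sum fun t _ ↦ (c t.1).le_of_opNorm_le (hc _) _
    _ = ∑ p ∈ range P, M * (a * ∑ k ∈ range K, ‖v k‖) ^ p := by
        rw [ExpansionIndex.box, sum_sigma]
        refine sum_congr rfl fun p _ ↦ ?_
        rw [mul_pow, sum_pow', ← mul_assoc, mul_sum]
    _ ≤ ∑ p ∈ range P, M * (1 / 2) ^ p := by gcongr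
    _ = M * ∑ p ∈ range P, (1 / 2 : ℝ) ^ p := by rw [mul_sum]
    _ ≤ M * 2 := by gcongr; exact sum_geometric_two_le P
    _ = 2 * M := mul_comm _ _

theorem summable_norm_expansion (hM : 0 ≤ M) (ha : 0 ≤ a) (hc : ∀ p, ‖c p‖ ≤ M * a ^ p)
    (hv : ∀ K, a * ∑ k ∈ range K, ‖v k‖ ≤ 1 / 2) :
    Summable fun t : ExpansionIndex ↦ ‖c t.1 fun k ↦ v (t.2 k)‖ := by
  refine summable_of_sum_le (c := 2 * M) (fun _ ↦ norm_nonneg _) fun s ↦ ?_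
  obtain ⟨n, hn⟩ := exists_subset_box s
  exact (sum_le_sum_of_subset_of_nonneg hn fun _ _ _ ↦ norm_nonneg _).trans
    (sum_box_norm_le hM ha hc (hv n) n)

theorem ContinuousMultilinearMap.hasSum_apply_of_summable {ι : Type*} [Fintype ι]
    (m : ContinuousMultilinearMap ℝ (fun _ : ι ↦ E) F) {s : E} (hv : HasSum v s)
    (hm : Summable fun i : ι → ℕ ↦ m fun k ↦ v (i k)) :
    HasSum (fun i : ι → ℕ ↦ m fun k ↦ v (i k)) (m fun _ ↦ s) := by
  classical
  have hbox : Filter.Tendsto (fun K ↦ Fintype.piFinset fun _ : ι ↦ range K)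
      Filter.atTop Filter.atTop := by
    refine Filter.tendsto_atTop_finset_of_monotone
      (fun K L h ↦ Fintype.piFinset_subset _ _ fun _ ↦ range_mono h) fun i ↦ ?_
    refine ⟨univ.sup i + 1, Fintype.mem_piFinset.2 fun k ↦ ?_⟩
    exact mem_range.2 (Nat.lt_succ_of_le (le_sup (mem_univ k)))
  have h1 := hm.hasSum.comp hbox
  have h2 : Filter.Tendsto (fun K ↦ m fun _ ↦ ∑ k ∈ range K, v k) Filter.atTop
      (nhds (m fun _ ↦ s)) :=
    (m.cont.tendsto _).comp (tendsto_pi_nhds.2 fun _ ↦ hv.tendsto_sum_nat)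
  convert hm.hasSum using 1
  refine tendsto_nhds_unique h2 (h1.congr fun K ↦ ?_)
  exact (m.map_sum_finset (fun _ ↦ v) fun _ ↦ range K).symm

/-- Expanding `∑ p, c p (s, …, s)` with `s = ∑ k, v k` and collecting terms by weight. -/
theorem hasSum_sum_ofWeight [CompleteSpace F]
    (hsum : Summable fun t : ExpansionIndex ↦ ‖c t.1 fun k ↦ v (t.2 k)‖) {s : E}
    (hv : HasSum v s) {y : F} (hy : HasSum (fun p ↦ c p fun _ ↦ s) y) :
    HasSum (fun n ↦ ∑ t ∈ ofWeight n, c t.1 fun k ↦ v (t.2 k)) y := by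
  have hs := hsum.of_norm
  have htot : HasSum (fun t : ExpansionIndex ↦ c t.1 fun k ↦ v (t.2 k)) y := by
    have h := hs.hasSum.sigma fun p ↦
      (c p).hasSum_apply_of_summable hv (hs.sigma_factor p)
    exact h.unique hy ▸ hs.hasSum
  refine ((Equiv.sigmaFiberEquiv weight).hasSum_iff.2 htot).sigma fun n ↦ ?_
  have h := (ofWeight n).hasSum fun t ↦ c t.1 fun k ↦ v (t.2 k)
  exact (Equiv.subtypeEquivRight fun _ ↦ mem_ofWeight.symm :
    {t // weight t = n} ≃ ofWeight n).hasSum_iff.2 h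

/-- The partial sums of `‖v k‖` stay bounded if `v n` is the sum of the terms of weight `n`. -/
theorem sum_norm_le_of_eq_sum_ofWeight {c : FormalMultilinearSeries ℝ E E} (hM : 0 ≤ M)
    (ha : 0 ≤ a) (hMa : M * a ≤ 1 / 4) (hc : ∀ p, ‖c p‖ ≤ M * a ^ p)
    (hv : ∀ n, v n = ∑ t ∈ ofWeight n, c t.1 fun k ↦ v (t.2 k)) (K : ℕ) :
    ∑ k ∈ range K, ‖v k‖ ≤ 2 * M := by
  induction K with
  | zero => simpa using hM
  | succ K ih =>
    have hK : a * ∑ k ∈ range K, ‖v k‖ ≤ 1 / 2 := by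
      nlinarith [mul_le_mul_of_nonneg_left ih ha]
    have hsub : ∀ k ∈ range (K + 1), ofWeight k = {t ∈ box (K + 1) K | t.weight = k} := by
      intro k hk
      have hk := mem_range.1 hk
      ext t
      refine ⟨fun h ↦ ?_, fun h ↦ mem_ofWeight.2 (mem_filter.1 h).2⟩
      have hb := mem_box.1 (mem_filter.1 h).1
      refine mem_filter.2 ⟨mem_box.2 ⟨by omega, fun i ↦ ?_⟩, mem_ofWeight.1 h⟩
      have := hb.2 i
      omega
    calc ∑ k ∈ range (K + 1), ‖v k‖
        ≤ ∑ k ∈ range (K + 1), ∑ t ∈ box (K + 1) K with t.weight = k,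
            ‖c t.1 fun k ↦ v (t.2 k)‖ := by
          refine sum_le_sum fun k hk ↦ ?_
          rw [← hsub k hk]
          nth_rw 1 [hv k]
          exact norm_sum_le _ _
      _ ≤ ∑ t ∈ box (K + 1) K, ‖c t.1 fun k ↦ v (t.2 k)‖ :=
          sum_fiberwise_le_sum_of_sum_fiber_nonneg fun _ _ ↦ sum_nonneg fun _ _ ↦ norm_nonneg _
      _ ≤ 2 * M := sum_box_norm_le hM ha hc hK _

end Expansion

theorem contDiffAt_of_hasSum_of_norm_le {E : Type*} [NormedAddCommGroup E] [NormedSpace ℝ E]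
    [CompleteSpace E] {N : E → E} {f : E} {c : FormalMultilinearSeries ℝ E E}
    (hc : ∀ x, HasSum (fun p ↦ c p fun _ ↦ x - f) (N x)) {M a : ℝ} (ha : 0 < a)
    (hM : ∀ p, ‖c p‖ ≤ M * a ^ p) : ContDiffAt ℝ ⊤ N f := by
  have h : HasFPowerSeriesOnBall N c f (ENNReal.ofReal a⁻¹) :=
    { r_le := by
        refine c.le_radius_of_bound M fun n ↦ ?_
        rw [Real.coe_toNNReal _ (inv_nonneg.2 ha.le), inv_pow, ← div_eq_mul_inv,
          div_le_iff₀ (pow_pos ha n)]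
        exact hM n
      r_pos := by simpa using ha
      hasSum := fun {y} _ ↦ by simpa using hc (f + y) }
  exact h.analyticAt.contDiffAt

open ExpansionIndex in
/-- If `u 0 = f` and each `u (n + 1)` is the sum of the terms of weight `n` in the expansion of `N`
around `f` in powers of `∑ n, u (n + 1)`, then `∑ n, u n` is a fixed point of `f + N`. -/
theorem tsum_eq_add_of_eq_sum_ofWeight {E : Type*} [NormedAddCommGroup E] [NormedSpace ℝ E]
    [CompleteSpace E] {N : E → E} {f : E} {c : FormalMultilinearSeries ℝ E E}
    (hexp : ∀ x, HasSum (fun p ↦ c p fun _ ↦ x - f) (N x)) {M a : ℝ} (hM : 0 ≤ M) (ha : 0 ≤ a)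
    (hMa : M * a ≤ 1 / 4) (hc : ∀ p, ‖c p‖ ≤ M * a ^ p) {u : ℕ → E} (hu0 : u 0 = f)
    (hu : ∀ n, u (n + 1) = ∑ t ∈ ofWeight n, c t.1 fun k ↦ u (t.2 k + 1)) :
    ∑' n, u n = f + N (∑' n, u n) := by
  have hbound : ∀ K, ∑ n ∈ Finset.range K, ‖u (n + 1)‖ ≤ 2 * M :=
    sum_norm_le_of_eq_sum_ofWeight (v := fun n ↦ u (n + 1)) hM ha hMa hc hu
  have hnsum : Summable fun n ↦ ‖u (n + 1)‖ :=
    summable_of_sum_range_le (fun _ ↦ norm_nonneg _) hbound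
  have hsum : Summable fun n ↦ u (n + 1) := hnsum.of_norm
  have htsum : ∑' n, u n = f + ∑' n, u (n + 1) := by
    rw [((summable_nat_add_iff 1).1 hsum).tsum_eq_zero_add, hu0]
  have hnorm := summable_norm_expansion (v := fun n ↦ u (n + 1)) hM ha hc fun K ↦ by
    nlinarith [mul_le_mul_of_nonneg_left (hbound K) ha]
  have key := hasSum_sum_ofWeight (c := c) (v := fun n ↦ u (n + 1)) (y := N (∑' n, u n)) hnorm
    hsum.hasSum (by simpa [htsum] using hexp (∑' n, u n))
  nth_rw 1 [htsum]
  rw [← key.tsum_eq, tsum_congr hu]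

/-- Under the hypotheses of the main theorem (`‖N^{(n)}(f)‖ ≤ M a^n n!`
with `M, a > 0`, `M a ≤ 1/4`), the sum `u = ∑_{n=0}^∞ u_n` of the Adomian series is a
solution of the equation `u = f + N(u)`. -/
theorem adomian_sum_solves_equation
    (N : X → X) (f : X) (M a : ℝ) (hM : 0 < M) (ha : 0 < a) (hMa : M * a ≤ 1 / 4)
    (hN : HasEntireExpansionAt N f)
    (hderiv : ∀ n : ℕ, ‖iteratedFDeriv ℝ n N f‖ ≤ M * a ^ n * n.factorial)
    (u : ℕ → X) (hu0 : u 0 = f) (hu : ∀ n : ℕ, u (n + 1) = adomianA N f u n) :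
    (∑' n : ℕ, u n) = f + N (∑' n : ℕ, u n) := by
  have hc : ∀ p, ‖(p.factorial : ℝ)⁻¹ • iteratedFDeriv ℝ p N f‖ ≤ M * a ^ p := fun p ↦ by
    rw [norm_smul, norm_inv, Real.norm_natCast, inv_mul_le_iff₀ (by positivity), mul_comm]
    exact hderiv p
  have hsmooth : ContDiffAt ℝ ⊤ N f := contDiffAt_of_hasSum_of_norm_le
    (c := fun p ↦ (p.factorial : ℝ)⁻¹ • iteratedFDeriv ℝ p N f) (fun x ↦ (hN x).1) ha hc
  exact tsum_eq_add_of_eq_sum_ofWeight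
    (c := fun p ↦ (p.factorial : ℝ)⁻¹ • iteratedFDeriv ℝ p N f) (fun x ↦ (hN x).1) hM.le ha.le hMa
    hc hu0 fun n ↦ (hu n).trans (adomianA_eq_sum_ofWeight hsmooth u n)
end

section
/- Let (w_n)_{n≥1} be the sequence of positive reals defined by w_1 = 1 and w_{n+1} = ∑_{j_1+2j_2+⋯+nj_n = n} ((j_1+⋯+j_n)!/(j_1!⋯j_n!))·w_1^{j_1}⋯w_n^{j_n} for n ≥ 1, the sum over tuples (j_1,…,j_n) of nonnegative integers with j_1+2j_2+⋯+nj_n = n. Then for every n ≥ 1, w_n equals the (n−1)-th Catalan number, w_n = (2n−2)!/((n−1)!·n!), and in particular w_n ≤ (2n−1)!/(n!)². -/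
open scoped BigOperators

open PowerSeries in
/-- The complete ordinary Bell polynomial sum over `adomianTuples n` is the `n`-th coefficient of
the truncated geometric series in `∑ i, a i * X ^ (i + 1)`. -/
theorem coeff_sum_range_pow_eq_sum_adomianTuples (a : ℕ → ℝ) (n : ℕ) :
    coeff n (∑ k ∈ Finset.range (n + 1),
        (∑ i : Fin n, C (a i) * (X : PowerSeries ℝ) ^ (i.1 + 1)) ^ k) =
      ∑ j ∈ adomianTuples n,
        (((∑ i : Fin n, j i).factorial : ℝ) / ∏ i : Fin n, ((j i).factorial : ℝ)) *
          ∏ i : Fin n, a i ^ j i := by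
  have hterm (j : Fin n → ℕ) :
      coeff n ((Nat.multinomial Finset.univ j : PowerSeries ℝ) *
        ∏ i : Fin n, (C (a i) * (X : PowerSeries ℝ) ^ (i.1 + 1)) ^ j i) =
      if ∑ i : Fin n, (i.1 + 1) * j i = n then
        (((∑ i : Fin n, j i).factorial : ℝ) / ∏ i : Fin n, ((j i).factorial : ℝ)) *
          ∏ i : Fin n, a i ^ j i
      else 0 := by
    have hprod : ∏ i : Fin n, (C (a i) * (X : PowerSeries ℝ) ^ (i.1 + 1)) ^ j i =
        C (∏ i : Fin n, a i ^ j i) * X ^ ∑ i : Fin n, (i.1 + 1) * j i := by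
      simp_rw [mul_pow, Finset.prod_mul_distrib, ← pow_mul, Finset.prod_pow_eq_pow_sum, map_prod,
        map_pow]
    have hmult : (Nat.multinomial Finset.univ j : ℝ) =
        ((∑ i : Fin n, j i).factorial : ℝ) / ∏ i : Fin n, ((j i).factorial : ℝ) := by
      rw [Nat.multinomial, Nat.cast_div (Nat.prod_factorial_dvd_factorial_sum _ _)
        (by exact_mod_cast (Finset.prod_pos fun i _ => Nat.factorial_pos (j i)).ne'),
        Nat.cast_prod]
    rw [hprod, ← map_natCast (C (R := ℝ)), ← mul_assoc, ← map_mul, coeff_C_mul, coeff_X_pow, hmult]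
    simp [eq_comm]
  have hset : adomianTuples n = ((Finset.range (n + 1)).biUnion
      fun k => Finset.piAntidiag (Finset.univ : Finset (Fin n)) k).filter
        fun j => ∑ i : Fin n, (i.1 + 1) * j i = n := by
    ext j
    simp only [adomianTuples, Finset.mem_filter, and_congr_left_iff, Fintype.mem_piFinset,
      Finset.mem_biUnion, Finset.mem_range, Finset.mem_piAntidiag, Finset.mem_univ, implies_true,
      and_true, exists_eq_right']
    intro hj
    have hle : ∑ i : Fin n, j i ≤ n :=
      (Finset.sum_le_sum fun i _ => Nat.le_mul_of_pos_left (j i) i.1.succ_pos).trans_eq hj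
    exact ⟨fun _ => Nat.lt_succ_of_le hle, fun _ i => Nat.lt_succ_of_le
      ((Finset.single_le_sum (fun _ _ => Nat.zero_le _) (Finset.mem_univ i)).trans hle)⟩
  rw [hset, Finset.sum_filter, Finset.sum_biUnion]
  · simp_rw [Finset.sum_pow_eq_sum_piAntidiag, map_sum, hterm]
  · intro k _ l _ hkl
    exact Finset.disjoint_left.2 fun j hk hl =>
      hkl ((Finset.mem_piAntidiag.1 hk).1.symm.trans (Finset.mem_piAntidiag.1 hl).1)

open PowerSeries in
/-- The Catalan numbers satisfy the recursion given by the sums over `adomianTuples n`. -/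
theorem sum_adomianTuples_catalan (n : ℕ) :
    ∑ j ∈ adomianTuples n,
        (((∑ i : Fin n, j i).factorial : ℝ) / ∏ i : Fin n, ((j i).factorial : ℝ)) *
          ∏ i : Fin n, (catalan i : ℝ) ^ j i = catalan n := by
  rw [← coeff_sum_range_pow_eq_sum_adomianTuples (fun i => (catalan i : ℝ))]
  set P : PowerSeries ℝ := ∑ i : Fin n, C (catalan i : ℝ) * X ^ (i.1 + 1) with hP
  set F : PowerSeries ℝ := catalanSeries.map (Nat.castRingHom ℝ) with hF
  have hcat : F ^ 2 * X + 1 = F := by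
    simpa using congrArg (PowerSeries.map (Nat.castRingHom ℝ)) catalanSeries_sq_mul_X_add_one
  have hdvd : X ^ (n + 1) ∣ P - F * X := by
    refine X_pow_dvd_iff.2 fun m hm => ?_
    rw [map_sub, sub_eq_zero, hP, map_sum]
    simp_rw [coeff_C_mul, coeff_X_pow]
    cases m with
    | zero => simp
    | succ m =>
      rw [coeff_succ_mul_X, Finset.sum_eq_single ⟨m, by omega⟩]
      · simp [hF]
      · intro i _ hi
        rw [if_neg fun h => hi (Fin.ext (Nat.succ_injective h).symm), mul_zero]
      · simp
  have hgeom : ∑ k ∈ Finset.range (n + 1), (F * X) ^ k = F - F * (F * X) ^ (n + 1) := by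
    linear_combination F * mul_neg_geom_sum (F * X) (n + 1) +
      (∑ k ∈ Finset.range (n + 1), (F * X) ^ k) * hcat
  have hsub : X ^ (n + 1) ∣ ∑ k ∈ Finset.range (n + 1), P ^ k - F := by
    have h₁ : X ^ (n + 1) ∣
        ∑ k ∈ Finset.range (n + 1), P ^ k - ∑ k ∈ Finset.range (n + 1), (F * X) ^ k := by
      rw [← Finset.sum_sub_distrib]
      exact Finset.dvd_sum fun k _ => hdvd.trans (sub_dvd_pow_sub_pow _ _ k)
    have h₂ : X ^ (n + 1) ∣ F * (F * X) ^ (n + 1) :=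
      (pow_dvd_pow_of_dvd (dvd_mul_left X F) _).mul_left F
    rw [hgeom] at h₁
    convert dvd_sub h₁ h₂ using 1
    ring
  have hcoeff := X_pow_dvd_iff.1 hsub n n.lt_succ_self
  rw [map_sub, sub_eq_zero] at hcoeff
  rw [hcoeff]
  simp [hF]

/-- The factorial formula for the Catalan numbers. -/
theorem catalan_eq_factorial_div (m : ℕ) :
    (catalan m : ℝ) = ((2 * m).factorial : ℝ) / ((m.factorial : ℝ) * ((m + 1).factorial : ℝ)) := by
  have h₁ : ((m : ℝ) + 1) * catalan m = m.centralBinom := by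
    exact_mod_cast succ_mul_catalan_eq_centralBinom m
  have h₂ : (m.centralBinom : ℝ) * m.factorial * m.factorial = (2 * m).factorial := by
    have := Nat.choose_mul_factorial_mul_factorial (show m ≤ 2 * m by omega)
    rw [show 2 * m - m = m by omega] at this
    exact_mod_cast this
  rw [eq_div_iff (by positivity), Nat.factorial_succ, ← h₂, ← h₁]
  push_cast
  ring

/-- If `(w_n)_{n≥1}` satisfies `w_1 = 1` and
`w_{n+1} = ∑_{j_1+2j_2+⋯+nj_n=n} ((j_1+⋯+j_n)!/(j_1!⋯j_n!)) w_1^{j_1} ⋯ w_n^{j_n}` for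
`n ≥ 1`, then `w_n` is the `(n-1)`-th Catalan number: `w_n = (2n-2)!/((n-1)!·n!)`, and in
particular `w_n ≤ (2n-1)!/(n!)²`. -/
theorem adomian_majorant_sequence_eq_catalan
    (w : ℕ → ℝ) (hw1 : w 1 = 1)
    (hw : ∀ n : ℕ, 1 ≤ n →
      w (n + 1) = ∑ j ∈ adomianTuples n,
        (((∑ i : Fin n, j i).factorial : ℝ) / ∏ i : Fin n, ((j i).factorial : ℝ)) *
          ∏ i : Fin n, w (i.1 + 1) ^ j i) :
    ∀ n : ℕ, 1 ≤ n →
      w n = (catalan (n - 1) : ℝ) ∧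
      w n = ((2 * n - 2).factorial : ℝ) / (((n - 1).factorial : ℝ) * (n.factorial : ℝ)) ∧
      w n ≤ ((2 * n - 1).factorial : ℝ) / ((n.factorial : ℝ)) ^ 2 := by
  have hcat (m : ℕ) : w (m + 1) = catalan m := by
    induction m using Nat.strong_induction_on with
    | _ m ih =>
      rcases m.eq_zero_or_pos with rfl | hm
      · simpa using hw1
      · rw [hw m hm, ← sum_adomianTuples_catalan m]
        exact Finset.sum_congr rfl fun j _ => by
          congr 1
          exact Finset.prod_congr rfl fun i _ => by rw [ih i i.2]
  intro n hn
  obtain ⟨m, rfl⟩ := Nat.exists_eq_add_of_le' hn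
  have hfac := catalan_eq_factorial_div m
  refine ⟨hcat m, ?_, ?_⟩
  · rw [hcat m, hfac]
    rfl
  · rw [hcat m, hfac, show 2 * (m + 1) - 1 = 2 * m + 1 by omega,
      div_le_div_iff₀ (by positivity) (by positivity), Nat.factorial_succ, Nat.factorial_succ]
    push_cast
    have hpos : (0 : ℝ) ≤ (2 * m).factorial * m.factorial ^ 2 * (m + 1) * m := by positivity
    nlinarith
end

section
/- Let (w_n)_{n≥1} be the sequence of positive reals defined by w_1 = 1 and w_{n+1} = ∑_{j_1+2j_2+⋯+nj_n = n} ((j_1+⋯+j_n)!/(j_1!⋯j_n!))·w_1^{j_1}⋯w_n^{j_n} for n ≥ 1. Then the formal power series S = ∑_{n≥1} w_n T^n ∈ ℝ[[T]] satisfies S·(1 − S) = T; equivalently, w_{n+1} = ∑_{k=1}^{n} w_k·w_{n+1−k} for all n ≥ 1. -/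
open scoped BigOperators

theorem mem_adomianTuples {n : ℕ} {j : Fin n → ℕ} :
    j ∈ adomianTuples n ↔ ∑ i : Fin n, (i.1 + 1) * j i = n := by
  refine ⟨fun h => (Finset.mem_filter.1 h).2, fun h => Finset.mem_filter.2 ⟨?_, h⟩⟩
  refine Fintype.mem_piFinset.2 fun i => Finset.mem_range_succ_iff.2 ?_
  calc j i ≤ (i.1 + 1) * j i := Nat.le_mul_of_pos_left _ i.1.succ_pos
    _ ≤ ∑ i : Fin n, (i.1 + 1) * j i :=
      Finset.single_le_sum (f := fun i : Fin n => (i.1 + 1) * j i) (fun _ _ => Nat.zero_le _)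
        (Finset.mem_univ i)
    _ = n := h

theorem sum_le_of_mem_adomianTuples {n : ℕ} {j : Fin n → ℕ} (h : j ∈ adomianTuples n) :
    ∑ i, j i ≤ n :=
  calc ∑ i, j i ≤ ∑ i : Fin n, (i.1 + 1) * j i :=
      Finset.sum_le_sum fun i _ => Nat.le_mul_of_pos_left _ i.1.succ_pos
    _ = n := mem_adomianTuples.1 h

/-- The sum over `adomianTuples n` is the `n`-th coefficient of a truncated geometric series. -/
theorem coeff_geom_sum_eq_sum_adomianTuples {R : Type*} [CommSemiring R] (n : ℕ)
    (a : Fin n → R) :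
    PowerSeries.coeff n (∑ m ∈ Finset.range (n + 1),
        (∑ i : Fin n, PowerSeries.C (a i) * PowerSeries.X ^ (i.1 + 1)) ^ m) =
      ∑ j ∈ adomianTuples n, (Nat.multinomial Finset.univ j : R) * ∏ i, a i ^ j i := by
  have coeff_pow (m : ℕ) : PowerSeries.coeff n
      ((∑ i : Fin n, PowerSeries.C (a i) * PowerSeries.X ^ (i.1 + 1)) ^ m) =
      ∑ j ∈ adomianTuples n with ∑ i, j i = m,
        (Nat.multinomial Finset.univ j : R) * ∏ i, a i ^ j i := by
    have filter_eq : (adomianTuples n).filter (fun j => ∑ i, j i = m) =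
        (Finset.univ.piAntidiag m).filter fun j => n = ∑ i : Fin n, (i.1 + 1) * j i := by
      ext j
      simp [mem_adomianTuples, and_comm, eq_comm]
    rw [Finset.sum_pow_eq_sum_piAntidiag, map_sum, filter_eq, Finset.sum_filter]
    refine Finset.sum_congr rfl fun j _ => ?_
    simp_rw [mul_pow, Finset.prod_mul_distrib, ← pow_mul, Finset.prod_pow_eq_pow_sum, ← map_pow,
      ← map_prod]
    rw [← map_natCast (PowerSeries.C (R := R)), PowerSeries.coeff_C_mul, PowerSeries.coeff_C_mul,
      PowerSeries.coeff_X_pow]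
    split_ifs <;> simp
  simp_rw [map_sum, coeff_pow]
  exact Finset.sum_fiberwise_of_maps_to
    (fun j hj => Finset.mem_range_succ_iff.2 (sum_le_of_mem_adomianTuples hj)) _

/-- Modulo `X ^ k`, the inverse of `1 - S` is the truncated geometric series of any `P`
congruent to `S`. -/
theorem X_pow_dvd_geom_sum_sub {R : Type*} [CommRing R] {S P U : PowerSeries R} {k : ℕ}
    (hU : (1 - S) * U = 1) (hPS : PowerSeries.X ^ k ∣ P - S) (hP : PowerSeries.X ∣ P) :
    PowerSeries.X ^ k ∣ (∑ m ∈ Finset.range k, P ^ m) - U := by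
  have key : (∑ m ∈ Finset.range k, P ^ m) - U =
      U * ((P - S) * (∑ m ∈ Finset.range k, P ^ m) - P ^ k) := by
    linear_combination (-(∑ m ∈ Finset.range k, P ^ m)) * hU + U * mul_neg_geom_sum P k
  rw [key]
  exact ((hPS.mul_right _).sub (pow_dvd_pow_of_dvd hP k)).mul_left _

/-- If `(w_n)_{n≥1}` satisfies `w_1 = 1` and
`w_{n+1} = ∑_{j_1+2j_2+⋯+nj_n=n} ((j_1+⋯+j_n)!/(j_1!⋯j_n!)) w_1^{j_1} ⋯ w_n^{j_n}` for
`n ≥ 1`, then the formal power series `S = ∑_{n≥1} w_n T^n ∈ ℝ[[T]]` satisfies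
`S(1 - S) = T`; equivalently, `w_{n+1} = ∑_{k=1}^n w_k w_{n+1-k}` for all `n ≥ 1`. -/
theorem adomian_majorant_series_functional_equation
    (w : ℕ → ℝ) (hw1 : w 1 = 1)
    (hw : ∀ n : ℕ, 1 ≤ n →
      w (n + 1) = ∑ j ∈ adomianTuples n,
        (((∑ i : Fin n, j i).factorial : ℝ) / ∏ i : Fin n, ((j i).factorial : ℝ)) *
          ∏ i : Fin n, w (i.1 + 1) ^ j i) :
    (PowerSeries.mk fun n : ℕ => if n = 0 then (0 : ℝ) else w n) *
        (1 - PowerSeries.mk fun n : ℕ => if n = 0 then (0 : ℝ) else w n) =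
      PowerSeries.X ∧
    ∀ n : ℕ, 1 ≤ n → w (n + 1) = ∑ k ∈ Finset.Icc 1 n, w k * w (n + 1 - k) := by
  set S : PowerSeries ℝ := PowerSeries.mk fun n : ℕ => if n = 0 then (0 : ℝ) else w n with hS
  have coeff_S (n : ℕ) : PowerSeries.coeff n S = if n = 0 then 0 else w n :=
    PowerSeries.coeff_mk _ _
  have S_eq : S = PowerSeries.X * PowerSeries.mk fun n => w (n + 1) := by
    ext (_ | n)
    · simp [hS]
    · rw [PowerSeries.coeff_succ_X_mul, coeff_S, PowerSeries.coeff_mk, if_neg n.succ_ne_zero]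
  have hU : (1 - S) * (1 - S)⁻¹ = 1 := PowerSeries.mul_inv_cancel _ (by simp [hS])
  have inv_eq : (PowerSeries.mk fun n => w (n + 1)) = (1 - S)⁻¹ := by
    ext n
    let P : PowerSeries ℝ := ∑ i : Fin n, PowerSeries.C (w (i.1 + 1)) * PowerSeries.X ^ (i.1 + 1)
    have hP : PowerSeries.X ∣ P := Finset.dvd_sum fun i _ =>
      (dvd_pow_self _ i.1.succ_ne_zero).mul_left _
    have hPS : PowerSeries.X ^ (n + 1) ∣ P - S := by
      refine PowerSeries.X_pow_dvd_iff.2 fun m hm => ?_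
      rw [map_sub, coeff_S, sub_eq_zero, map_sum]
      simp_rw [PowerSeries.coeff_C_mul, PowerSeries.coeff_X_pow]
      rcases m with _ | m
      · simp
      · rw [Finset.sum_eq_single ⟨m, by omega⟩]
        · simp
        · intro i _ hi
          have : m ≠ i.1 := fun h => hi (Fin.ext h.symm)
          simp [this]
        · simp
    have hcoeff := PowerSeries.X_pow_dvd_iff.1 (X_pow_dvd_geom_sum_sub hU hPS hP) n n.lt_succ_self
    rw [map_sub, sub_eq_zero, coeff_geom_sum_eq_sum_adomianTuples] at hcoeff
    rw [← hcoeff, PowerSeries.coeff_mk]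
    have hw' : w (n + 1) = ∑ j ∈ adomianTuples n,
        (((∑ i : Fin n, j i).factorial : ℝ) / ∏ i : Fin n, ((j i).factorial : ℝ)) *
          ∏ i : Fin n, w (i.1 + 1) ^ j i := by
      rcases n with _ | n
      · simp [hw1, adomianTuples]
      · exact hw _ n.succ_pos
    rw [hw']
    refine Finset.sum_congr rfl fun j _ => ?_
    rw [Nat.multinomial, Nat.cast_div (Nat.prod_factorial_dvd_factorial_sum _ _)
      (by exact_mod_cast Finset.prod_ne_zero_iff.2 fun i _ => (j i).factorial_ne_zero),
      Nat.cast_prod]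
  have main : S * (1 - S) = PowerSeries.X := by
    rw [← inv_eq] at hU
    linear_combination PowerSeries.X * hU + (1 - S) * S_eq
  refine ⟨main, fun n hn => ?_⟩
  have hsq : S = PowerSeries.X + S * S := by linear_combination main
  have hcoeff := congrArg (PowerSeries.coeff (n + 1)) hsq
  rw [map_add, PowerSeries.coeff_mul, PowerSeries.coeff_X, if_neg (by omega), zero_add, coeff_S,
    if_neg n.succ_ne_zero, Finset.Nat.sum_antidiagonal_eq_sum_range_succ_mk] at hcoeff
  rw [hcoeff]
  symm
  refine Finset.sum_subset_zero_on_sdiff (fun k hk => ?_) (fun k hk => ?_) fun k hk => ?_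
  · simp only [Finset.mem_Icc] at hk
    simp only [Finset.mem_range]
    omega
  · simp only [Finset.mem_sdiff, Finset.mem_range, Finset.mem_Icc] at hk
    obtain rfl | rfl : k = 0 ∨ k = n + 1 := by omega
    · simp [coeff_S]
    · simp [coeff_S]
  · simp only [Finset.mem_Icc] at hk
    rw [coeff_S, coeff_S, if_neg (by omega), if_neg (by omega)]
end

section
/- For every integer j ≥ 2, ((2j)!·(2j+1))/((j!)²·(j+1)²) ≤ (4/√(3π))·4^j·j^{−3/2}; consequently, for every x ≥ 0 and every integer j ≥ 2, ((2j)!·(2j+1))/((j!)²·(j+1)²)·x^j ≤ (4/(√(3π)·j√j))·(4x)^j. -/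
open scoped BigOperators

/-- An upper bound for the squared central binomial coefficient, from the Wallis product. -/
theorem factorial_two_mul_sq_le (n : ℕ) :
    ((2 * n).factorial : ℝ) ^ 2 * ((2 * n + 1) ^ 2 * Real.pi) ≤
      4 * (n + 1) * (4 ^ n) ^ 2 * (n.factorial : ℝ) ^ 4 := by
  have h := Real.Wallis.le_W n
  rw [Real.Wallis.W_eq_factorial_ratio, div_mul_div_comm,
    div_le_div_iff₀ (by positivity) (by positivity)] at h
  have e : (2 : ℝ) ^ (4 * n) = (4 ^ n) ^ 2 := by
    rw [← pow_mul, mul_comm n 2, pow_mul, pow_mul]; norm_num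
  rw [e] at h
  linarith

theorem rpow_neg_three_halves {x : ℝ} (hx : 0 < x) :
    x ^ (-(3 / 2 : ℝ)) = (x * Real.sqrt x)⁻¹ := by
  rw [Real.rpow_neg hx.le, show (3 / 2 : ℝ) = 1 + 1 / 2 by norm_num, Real.rpow_add hx,
    Real.rpow_one, Real.sqrt_eq_rpow]

theorem factorial_ratio_le (j : ℕ) (hj : 0 < j) :
    ((2 * j).factorial : ℝ) * (2 * j + 1) / (((j.factorial : ℝ)) ^ 2 * ((j : ℝ) + 1) ^ 2) ≤
      4 / (Real.sqrt (3 * Real.pi) * (j : ℝ) * Real.sqrt j) * 4 ^ j := by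
  have hj' : (0 : ℝ) < j := by exact_mod_cast hj
  have hpi := Real.pi_pos
  refine le_of_sq_le_sq ?_ (by positivity)
  have hs : Real.sqrt (3 * Real.pi) ^ 2 = 3 * Real.pi := Real.sq_sqrt (by positivity)
  have hsj : Real.sqrt j ^ 2 = j := Real.sq_sqrt hj'.le
  calc (((2 * j).factorial : ℝ) * (2 * j + 1) /
        (((j.factorial : ℝ)) ^ 2 * ((j : ℝ) + 1) ^ 2)) ^ 2
      ≤ 4 * (4 ^ j) ^ 2 / (Real.pi * ((j : ℝ) + 1) ^ 3) := by
        rw [div_pow, div_le_div_iff₀ (by positivity) (by positivity)]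
        have h := mul_le_mul_of_nonneg_right (factorial_two_mul_sq_le j)
          (by positivity : (0 : ℝ) ≤ ((j : ℝ) + 1) ^ 3)
        linarith
    _ ≤ 16 * (4 ^ j) ^ 2 / (3 * Real.pi * (j : ℝ) ^ 3) := by
        have hle : (j : ℝ) ^ 3 ≤ ((j : ℝ) + 1) ^ 3 := by gcongr; linarith
        have hc : (4 : ℝ) * (4 ^ j) ^ 2 / (Real.pi * ((j : ℝ) + 1) ^ 3) =
            12 * (4 ^ j) ^ 2 / (3 * Real.pi * ((j : ℝ) + 1) ^ 3) := by
          field_simp; norm_num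
        rw [hc]
        gcongr
        norm_num
    _ = (4 / (Real.sqrt (3 * Real.pi) * (j : ℝ) * Real.sqrt j) * 4 ^ j) ^ 2 := by
        rw [mul_pow, div_pow, mul_pow, mul_pow, hs, hsj]
        field_simp
        norm_num

/-- For every integer `j ≥ 2`,
`((2j)!(2j+1))/((j!)²(j+1)²) ≤ (4/√(3π)) 4^j j^{-3/2}`; consequently, for every `x ≥ 0` and
every integer `j ≥ 2`, `((2j)!(2j+1))/((j!)²(j+1)²) x^j ≤ (4/(√(3π) j √j)) (4x)^j`. -/
theorem central_binomial_type_estimate :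
    (∀ j : ℕ, 2 ≤ j →
      ((2 * j).factorial : ℝ) * (2 * j + 1) / (((j.factorial : ℝ)) ^ 2 * ((j : ℝ) + 1) ^ 2) ≤
        4 / Real.sqrt (3 * Real.pi) * 4 ^ j * (j : ℝ) ^ (-(3 / 2 : ℝ))) ∧
    ∀ x : ℝ, 0 ≤ x → ∀ j : ℕ, 2 ≤ j →
      ((2 * j).factorial : ℝ) * (2 * j + 1) / (((j.factorial : ℝ)) ^ 2 * ((j : ℝ) + 1) ^ 2) *
          x ^ j ≤
        4 / (Real.sqrt (3 * Real.pi) * (j : ℝ) * Real.sqrt j) * (4 * x) ^ j := by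
  constructor
  · intro j hj
    refine (factorial_ratio_le j (by omega)).trans_eq ?_
    have hj' : (0 : ℝ) < j := by exact_mod_cast (by omega : 0 < j)
    rw [rpow_neg_three_halves hj']
    simp only [div_eq_mul_inv, mul_inv]
    ring
  · intro x hx j hj
    rw [mul_pow, ← mul_assoc]
    exact mul_le_mul_of_nonneg_right (factorial_ratio_le j (by omega)) (pow_nonneg hx j)
end

section
/- Let X be a real Banach space, let N : X → X be analytic with infinite radius of convergence, and let (v_j)_{j≥0} be a sequence in X with ∑_{j=0}^{∞} ‖v_j‖ < ∞. Then for every n ∈ ℕ, the n-th derivative at ε = 0 of ε ↦ N(∑_{j=0}^{∞} ε^j v_j) (defined for ε in a neighborhood of 0 where the series converges) equals the n-th derivative at ε = 0 of the map ε ↦ N(∑_{j=0}^{n} ε^j v_j); that is, the n-th Adomian polynomial depends only on v_0, v_1, …, v_n. -/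
open scoped BigOperators

variable {X : Type*} [NormedAddCommGroup X] [NormedSpace ℝ X] [CompleteSpace X]

/-- **Polarization formula** with an arbitrary base point `x₀`: the symmetrization of a
multilinear map is an alternating sum of values on the diagonal. -/
theorem MultilinearMap.sum_perm_eq_sum_neg_one_pow_card_smul {R E F : Type*} [CommRing R]
    [AddCommGroup E] [Module R E] [AddCommGroup F] [Module R F] {n : ℕ}
    (f : MultilinearMap R (fun _ : Fin n => E) F) (x₀ : E) (h : Fin n → E) :
    ∑ σ : Equiv.Perm (Fin n), f (fun i => h (σ i)) =
      ∑ s : Finset (Fin n), (-1 : ℤ) ^ s.card • f (fun _ => x₀ + ∑ i ∈ sᶜ, h i) := by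
  classical
  let g : Option (Fin n) → E := fun o => o.elim x₀ h
  let missed : (Fin n → Option (Fin n)) → Finset (Fin n) :=
    fun r => Finset.univ.filter fun i => ∀ k, r k ≠ some i
  have expand (s : Finset (Fin n)) : f (fun _ => x₀ + ∑ i ∈ sᶜ, h i) =
      ∑ r : Fin n → Option (Fin n), if s ⊆ missed r then f (fun i => g (r i)) else 0 := by
    have hsum : x₀ + ∑ i ∈ sᶜ, h i = ∑ o ∈ Finset.insertNone sᶜ, g o := by
      simp [g]
    rw [hsum, f.map_sum_finset (fun _ => g) (fun _ => Finset.insertNone sᶜ),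
      ← Finset.sum_filter]
    refine Finset.sum_congr ?_ fun _ _ => rfl
    ext r
    simp only [Fintype.mem_piFinset, Finset.mem_insertNone, Finset.mem_compl, Finset.mem_filter,
      Finset.mem_univ, true_and, Finset.subset_iff, missed]
    exact ⟨fun H i hi k hk => H k i hk hi, fun H k i hk hi => H hi k hk⟩
  simp_rw [expand, Finset.smul_sum]
  rw [Finset.sum_comm]
  have alternating (r : Fin n → Option (Fin n)) :
      ∑ s : Finset (Fin n), (-1 : ℤ) ^ s.card •
        (if s ⊆ missed r then f (fun i => g (r i)) else 0) =
      if missed r = ∅ then f (fun i => g (r i)) else 0 := by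
    have : (Finset.univ.filter fun s => s ⊆ missed r) = (missed r).powerset := by
      ext s; simp
    simp_rw [smul_ite, smul_zero]
    rw [← Finset.sum_filter, this, ← Finset.sum_smul, Finset.sum_powerset_neg_one_pow_card]
    simp
  simp_rw [alternating]
  rw [← Finset.sum_filter]
  refine Finset.sum_bij (fun σ _ => fun k => some (σ k)) ?_ ?_ ?_ ?_
  · intro σ _
    simp only [Finset.mem_filter, Finset.mem_univ, true_and, missed, Finset.filter_eq_empty_iff]
    intro i _ H
    exact H (σ.symm i) (by simp)
  · intro σ _ τ _ H
    ext k
    simpa using congrArg Fin.val (Option.some_injective _ (congrFun H k))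
  · intro r hr
    simp only [Finset.mem_filter, Finset.mem_univ, true_and, missed, Finset.filter_eq_empty_iff,
      not_forall, not_not, forall_const] at hr
    choose t ht using fun i => hr (x := i)
    have t_inj : Function.Injective t := fun i j hij => by
      have := ht i
      rw [hij, ht j] at this
      exact (Option.some_injective _ this).symm
    have t_bij := Finite.injective_iff_bijective.mp t_inj
    refine ⟨(Equiv.ofBijective t t_bij).symm, Finset.mem_univ _, ?_⟩
    funext k
    obtain ⟨i, rfl⟩ := t_bij.2 k
    rw [ht]
    exact congrArg some ((Equiv.ofBijective t t_bij).symm_apply_apply i)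
  · intro σ _
    rfl

section EntireSeries

variable {E F : Type*} [NormedAddCommGroup E] [NormedSpace ℝ E]
  [NormedAddCommGroup F] [NormedSpace ℝ F]

/-- The average of a multilinear map over all permutations of its arguments. -/
noncomputable def ContinuousMultilinearMap.symmetrize {n : ℕ} (f : E [×n]→L[ℝ] F) :
    E [×n]→L[ℝ] F :=
  (n.factorial : ℝ)⁻¹ • ∑ σ : Equiv.Perm (Fin n), f.domDomCongr σ

theorem ContinuousMultilinearMap.symmetrize_apply {n : ℕ} (f : E [×n]→L[ℝ] F)
    (m : Fin n → E) :
    f.symmetrize m = (n.factorial : ℝ)⁻¹ • ∑ σ : Equiv.Perm (Fin n), f fun i => m (σ i) := by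
  simp [symmetrize]

theorem ContinuousMultilinearMap.symmetrize_apply_diag {n : ℕ} (f : E [×n]→L[ℝ] F) (x : E) :
    (f.symmetrize fun _ => x) = f fun _ => x := by
  rw [symmetrize_apply, Finset.sum_const, Finset.card_univ, Fintype.card_perm, Fintype.card_fin,
    ← Nat.cast_smul_eq_nsmul ℝ, inv_smul_smul₀ (by positivity)]

/-- A bound on the diagonal over some ball, centered anywhere, controls the norm of the
symmetrization. -/
theorem ContinuousMultilinearMap.norm_symmetrize_le {n : ℕ} (f : E [×n]→L[ℝ] F) {x₀ : E}
    {r K : ℝ} (hr : 0 < r) (hf : ∀ x ∈ Metric.ball x₀ r, ‖f fun _ => x‖ ≤ K) :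
    ‖f.symmetrize‖ ≤ (n.factorial : ℝ)⁻¹ * (2 ^ n * K) * ((n + 1) / r) ^ n := by
  have hK : 0 ≤ K := (norm_nonneg _).trans (hf x₀ (Metric.mem_ball_self hr))
  have small (m : Fin n → E) (hm : ∀ i, ‖m i‖ ≤ r / (n + 1)) :
      ‖f.symmetrize m‖ ≤ (n.factorial : ℝ)⁻¹ * (2 ^ n * K) := by
    rw [symmetrize_apply, norm_smul, norm_inv, Real.norm_natCast]
    gcongr
    have key := f.toMultilinearMap.sum_perm_eq_sum_neg_one_pow_card_smul x₀ m
    simp only [ContinuousMultilinearMap.coe_coe] at key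
    rw [key]
    refine (norm_sum_le_of_le (f := fun s : Finset (Fin n) => _) (n := fun _ => K)
      Finset.univ fun s _ => ?_).trans_eq (by simp)
    have hsign (y : F) : ‖(-1 : ℤ) ^ s.card • y‖ = ‖y‖ := by
      rcases neg_one_pow_eq_or ℤ s.card with h | h <;> simp [h]
    rw [hsign]
    apply hf
    rw [Metric.mem_ball, dist_eq_norm, add_sub_cancel_left]
    calc ‖∑ i ∈ sᶜ, m i‖ ≤ ∑ i ∈ sᶜ, r / (n + 1) := norm_sum_le_of_le _ fun i _ => hm i
      _ ≤ ∑ i : Fin n, r / (n + 1) :=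
        Finset.sum_le_sum_of_subset_of_nonneg (Finset.subset_univ _) fun _ _ _ => by positivity
      _ = n / (n + 1) * r := by simp; ring
      _ < 1 * r := by
        gcongr
        rw [div_lt_one (by positivity)]
        linarith
      _ = r := one_mul r
  refine ContinuousMultilinearMap.opNorm_le_bound (by positivity) fun m => ?_
  by_cases hm : ∃ i, m i = 0
  · obtain ⟨i, hi⟩ := hm
    rw [f.symmetrize.map_coord_zero i hi, norm_zero]
    positivity
  push Not at hm
  have hm' (i : Fin n) : 0 < ‖m i‖ := norm_pos_iff.mpr (hm i)
  have scaled := small (fun i => (r / (n + 1) / ‖m i‖) • m i) fun i => by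
    rw [norm_smul, Real.norm_of_nonneg (by positivity), div_mul_cancel₀ _ (hm' i).ne']
  rw [f.symmetrize.map_smul_univ, norm_smul, Real.norm_of_nonneg (by positivity),
    Finset.prod_div_distrib, Finset.prod_const, Finset.card_univ, Fintype.card_fin] at scaled
  have hprod : 0 < ∏ i, ‖m i‖ := Finset.prod_pos fun i _ => hm' i
  have hinv : ((n + 1) / r) ^ n * (r / (n + 1)) ^ n = 1 := by
    rw [← mul_pow, div_mul_div_cancel₀ hr.ne', div_self (by positivity), one_pow]
  calc ‖f.symmetrize m‖
      = ((r / (n + 1)) ^ n / (∏ i, ‖m i‖) * ‖f.symmetrize m‖) *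
          (((n + 1) / r) ^ n * ∏ i, ‖m i‖) := by
        rw [div_mul_eq_mul_div, div_mul_eq_mul_div, eq_div_iff hprod.ne']
        linear_combination (-‖f.symmetrize m‖ * ∏ i, ‖m i‖) * hinv
    _ ≤ (n.factorial : ℝ)⁻¹ * (2 ^ n * K) * (((n + 1) / r) ^ n * ∏ i, ‖m i‖) := by gcongr
    _ = _ := by ring

/-- On a Banach space, a function given by an everywhere (pointwise) convergent series of
homogeneous polynomials is analytic. -/
theorem analyticAt_of_forall_hasSum [CompleteSpace E] {f : E → F} {a : E}
    (p : FormalMultilinearSeries ℝ E F)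
    (h : ∀ y, HasSum (fun n => p n fun _ => y) (f (a + y))) : AnalyticAt ℝ f a := by
  obtain ⟨k, x₀, hx₀⟩ : ∃ k : ℕ, (interior {y : E | ∀ n, ‖p n fun _ => y‖ ≤ k}).Nonempty := by
    refine nonempty_interior_of_iUnion_of_closed (fun k => ?_) ?_
    · simp only [Set.ofPred_forall]
      refine isClosed_iInter fun n => isClosed_le ?_ continuous_const
      exact ((p n).cont.comp (continuous_pi fun _ => continuous_id)).norm
    · refine Set.eq_univ_of_forall fun y => Set.mem_iUnion.mpr ?_
      obtain ⟨C, hC⟩ := (h y).summable.tendsto_atTop_zero.norm.bddAbove_range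
      obtain ⟨k, hk⟩ := exists_nat_ge C
      exact ⟨k, fun n => (hC ⟨n, rfl⟩).trans hk⟩
  obtain ⟨r, hr, hball⟩ := Metric.isOpen_iff.mp isOpen_interior x₀ hx₀
  let q : FormalMultilinearSeries ℝ E F := fun n => (p n).symmetrize
  have hq (n : ℕ) : ‖q n‖ ≤ (n.factorial : ℝ)⁻¹ * (2 ^ n * k) * ((n + 1) / r) ^ n :=
    (p n).norm_symmetrize_le hr fun x hx => interior_subset (hball hx) n
  have hρ : 0 < r / (2 * Real.exp 1) := by positivity
  have hradius : ((NNReal.mk (r / (2 * Real.exp 1)) hρ.le : NNReal) : ENNReal) ≤ q.radius := by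
    refine q.le_radius_of_bound (k * Real.exp 1) fun n => ?_
    have hexp : ((n : ℝ) + 1) ^ n / n.factorial ≤ Real.exp 1 ^ n * Real.exp 1 := by
      rw [← pow_succ, ← Real.exp_nat_mul, mul_one, Nat.cast_add_one]
      exact Real.pow_div_factorial_le_exp _ (by positivity) n
    calc ‖q n‖ * (r / (2 * Real.exp 1)) ^ n
        ≤ (n.factorial : ℝ)⁻¹ * (2 ^ n * k) * ((n + 1) / r) ^ n *
            (r / (2 * Real.exp 1)) ^ n := by gcongr; exact hq n
      _ = k * (((n : ℝ) + 1) ^ n / n.factorial) / Real.exp 1 ^ n := by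
        simp only [div_pow, mul_pow]
        field_simp
      _ ≤ k * (Real.exp 1 ^ n * Real.exp 1) / Real.exp 1 ^ n := by gcongr
      _ = k * Real.exp 1 := by field_simp
  refine ⟨q, _, hradius, ENNReal.coe_pos.mpr hρ, fun {y} _ => ?_⟩
  simpa only [q, ContinuousMultilinearMap.symmetrize_apply_diag] using h y

end EntireSeries

/-- Analytic functions of one variable which agree up to `O(ε ^ (n + 1))` have the same `n`-th
derivative. -/
theorem iteratedDeriv_eq_of_sub_isBigO {F : Type*} [NormedAddCommGroup F] [NormedSpace ℝ F]
    [CompleteSpace F] {f g : ℝ → F} {n : ℕ} (hf : AnalyticAt ℝ f 0) (hg : AnalyticAt ℝ g 0)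
    (hfg : (fun ε => f ε - g ε) =O[nhds 0] fun ε => ε ^ (n + 1)) :
    iteratedDeriv n f 0 = iteratedDeriv n g 0 := by
  have hsub : AnalyticAt ℝ (fun ε => f ε - g ε) 0 := hf.fun_sub hg
  have horder : ((n + 1 : ℕ) : ℕ∞) ≤ analyticOrderAt (fun ε => f ε - g ε) 0 := by
    by_contra! hlt
    obtain ⟨k, hk⟩ := ENat.ne_top_iff_exists.mp (ne_top_of_lt hlt)
    rw [← hk, Nat.cast_lt] at hlt
    obtain ⟨h, hh, hh0, hfac⟩ := (hsub.analyticOrderAt_eq_natCast).mp hk.symm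
    obtain ⟨C, hC⟩ := hfg.bound
    refine hh0 (norm_le_zero_iff.mp ?_)
    have hbound : ∀ᶠ ε in nhdsWithin (0 : ℝ) {0}ᶜ, ‖h ε‖ ≤ C * ‖ε‖ ^ (n + 1 - k) := by
      filter_upwards [hfac.filter_mono nhdsWithin_le_nhds, hC.filter_mono nhdsWithin_le_nhds,
        self_mem_nhdsWithin] with ε h₁ h₂ hε
      have hpos : 0 < ‖ε‖ ^ k := pow_pos (norm_pos_iff.mpr hε) k
      rw [h₁, sub_zero, norm_smul, norm_pow, norm_pow, ← Nat.add_sub_of_le hlt.le, pow_add,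
        mul_left_comm] at h₂
      exact le_of_mul_le_mul_left h₂ hpos
    have hlim : Filter.Tendsto (fun ε : ℝ => C * ‖ε‖ ^ (n + 1 - k)) (nhds 0) (nhds 0) := by
      have hcont : Continuous fun ε : ℝ => C * ‖ε‖ ^ (n + 1 - k) := by fun_prop
      simpa [Nat.sub_ne_zero_of_lt hlt] using hcont.tendsto 0
    exact le_of_tendsto_of_tendsto (hh.continuousAt.norm.tendsto.mono_left nhdsWithin_le_nhds)
      (hlim.mono_left nhdsWithin_le_nhds) hbound
  have hzero := (natCast_le_analyticOrderAt_iff_iteratedDeriv_eq_zero hsub).mp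
    horder n n.lt_succ_self
  rwa [iteratedDeriv_fun_sub hf.contDiffAt hg.contDiffAt, sub_eq_zero] at hzero

theorem HasEntireExpansionAt.analyticAt {N : X → X} {a : X} (hN : HasEntireExpansionAt N a) :
    AnalyticAt ℝ N a :=
  analyticAt_of_forall_hasSum (fun p => (p.factorial : ℝ)⁻¹ • iteratedFDeriv ℝ p N a) fun y => by
    simpa using (hN (a + y)).1

theorem hasFPowerSeriesAt_tsum_pow_smul {F : Type*} [NormedAddCommGroup F] [NormedSpace ℝ F]
    [CompleteSpace F] {v : ℕ → F} (hv : Summable fun j => ‖v j‖) :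
    HasFPowerSeriesAt (fun ε : ℝ => ∑' j, ε ^ j • v j)
      (fun j => ContinuousMultilinearMap.mkPiRing ℝ (Fin j) (v j)) 0 := by
  let p : FormalMultilinearSeries ℝ ℝ F :=
    fun j => ContinuousMultilinearMap.mkPiRing ℝ (Fin j) (v j)
  have hradius : ((1 : NNReal) : ENNReal) ≤ p.radius := by
    obtain ⟨C, hC⟩ := hv.tendsto_atTop_zero.bddAbove_range
    refine p.le_radius_of_bound C fun j => ?_
    simpa [p, ContinuousMultilinearMap.norm_mkPiRing] using hC ⟨j, rfl⟩
  have hp := (p.hasFPowerSeriesOnBall (lt_of_lt_of_le (by simp) hradius)).hasFPowerSeriesAt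
  have hsum : p.sum = fun ε : ℝ => ∑' j, ε ^ j • v j := by
    funext ε
    simp [FormalMultilinearSeries.sum, p]
  rwa [hsum] at hp

/-- Let `N : X → X` be analytic with infinite radius of convergence and let
`(v_j)` be a sequence in `X` with `∑ ‖v_j‖ < ∞`. Then for every `n`, the `n`-th derivative at
`ε = 0` of `ε ↦ N(∑_{j=0}^∞ ε^j v_j)` equals the `n`-th derivative at `ε = 0` of
`ε ↦ N(∑_{j=0}^n ε^j v_j)`: the `n`-th Adomian polynomial depends only on `v_0, …, v_n`. -/
theorem adomian_polynomial_depends_on_first_terms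
    (N : X → X) (hN : ∀ a : X, HasEntireExpansionAt N a)
    (v : ℕ → X) (hv : Summable fun j : ℕ => ‖v j‖) (n : ℕ) :
    iteratedDeriv n (fun ε : ℝ => N (∑' j : ℕ, ε ^ j • v j)) 0 =
      iteratedDeriv n (fun ε : ℝ => N (∑ j ∈ Finset.range (n + 1), ε ^ j • v j)) 0 := by
  have hu := hasFPowerSeriesAt_tsum_pow_smul hv
  have hw : AnalyticAt ℝ (fun ε : ℝ => ∑ j ∈ Finset.range (n + 1), ε ^ j • v j) 0 := by
    fun_prop
  have hu0 : ∑' j : ℕ, (0 : ℝ) ^ j • v j = v 0 := by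
    rw [tsum_eq_single 0 fun j hj => by simp [hj]]
    simp
  have hw0 : ∑ j ∈ Finset.range (n + 1), (0 : ℝ) ^ j • v j = v 0 := by
    simp [Finset.sum_range_succ']
  have hNv := (hN (v 0)).analyticAt
  refine iteratedDeriv_eq_of_sub_isBigO (hNv.comp_of_eq hu.analyticAt hu0)
    (hNv.comp_of_eq hw hw0) ?_
  have htail : (fun ε : ℝ => ∑' j : ℕ, ε ^ j • v j -
      ∑ j ∈ Finset.range (n + 1), ε ^ j • v j) =O[nhds 0] fun ε => ε ^ (n + 1) := by
    rw [← Asymptotics.isBigO_norm_right]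
    simpa [FormalMultilinearSeries.partialSum] using
      hu.isBigO_sub_partialSum_pow (n + 1)
  have hpair : Filter.Tendsto (fun ε : ℝ => (∑' j : ℕ, ε ^ j • v j,
      ∑ j ∈ Finset.range (n + 1), ε ^ j • v j)) (nhds 0) (nhds (v 0, v 0)) := by
    have := hu.analyticAt.continuousAt.prodMk hw.continuousAt
    rwa [ContinuousAt, hu0, hw0] at this
  exact (hNv.hasStrictFDerivAt.isBigO_sub.comp_tendsto hpair).trans htail
end
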